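/- Every continuous group homomorphism Φ : SU(2) → SU(2) is either trivial or bijective. -/

import Mathlib

open Complex ComplexConjugate

namespace SU2

/-- The group SU(2). -/
abbrev Grp := ↥(Matrix.specialUnitaryGroup (Fin 2) ℂ)

/-- The upper left entry of a matrix in SU(2). -/
def α (u : Grp) : ℂ := u.1 0 0

/-- The lower left entry of a matrix in SU(2). -/
def β (u : Grp) : ℂ := u.1 1 0

/-- The matrix in SU(2) with first column `(a, b)`. -/
def mk (a b : ℂ) (h : a * conj a + b * conj b = 1) : Grp :=
  ⟨!![a, -conj b; b, conj a], by
    rw [Matrix.mem_specialUnitaryGroup_iff, Matrix.mem_unitaryGroup_iff']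
    constructor
    · ext i j
      fin_cases i <;> fin_cases j <;>
        simp [Matrix.mul_apply, Fin.sum_univ_two, Matrix.star_apply] <;>
          first | ring1 | linear_combination h
    · rw [Matrix.det_fin_two_of]
      linear_combination h⟩

@[simp] theorem α_mk (a b h) : α (mk a b h) = a := rfl

@[simp] theorem β_mk (a b h) : β (mk a b h) = b := rfl

theorem entries (u : Grp) : u.1 0 1 = -conj (β u) ∧ u.1 1 1 = conj (α u) := by
  have hdet := u.2.2
  have h1 := Matrix.mem_unitaryGroup_iff.1 u.2.1
  have h2 : star u.1 = u.1.adjugate := by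
    calc star u.1 = (u.1.adjugate * u.1) * star u.1 := by
          rw [Matrix.adjugate_mul, show u.1.det = 1 from hdet]; simp
      _ = u.1.adjugate := by rw [mul_assoc, h1, mul_one]
  rw [Matrix.adjugate_fin_two] at h2
  have e1 := congrFun (congrFun h2 0) 0
  have e2 := congrFun (congrFun h2 0) 1
  simp [Matrix.star_apply] at e1 e2
  exact ⟨by rw [β, e2, neg_neg], by rw [α, e1]⟩

theorem norm_eq (u : Grp) : α u * conj (α u) + β u * conj (β u) = 1 := by
  have h : u.1.det = 1 := u.2.2
  rw [Matrix.det_fin_two, (entries u).1, (entries u).2] at h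
  change α u * conj (α u) - -conj (β u) * β u = 1 at h
  linear_combination h

theorem ext {u v : Grp} (h1 : α u = α v) (h2 : β u = β v) : u = v := by
  apply Subtype.ext
  ext i j
  fin_cases i <;> fin_cases j
  · exact h1
  · exact (entries u).1.trans (by rw [h2]; exact (entries v).1.symm)
  · exact h2
  · exact (entries u).2.trans (by rw [h1]; exact (entries v).2.symm)

@[simp] theorem α_mul (u v : Grp) : α (u * v) = α u * α v - conj (β u) * β v := by
  have : α (u * v) = u.1 0 0 * v.1 0 0 + u.1 0 1 * v.1 1 0 := by
    simp [α, Matrix.mul_apply, Fin.sum_univ_two]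
  rw [this, (entries u).1, α, α, β, β]
  ring

@[simp] theorem β_mul (u v : Grp) : β (u * v) = β u * α v + conj (α u) * β v := by
  have : β (u * v) = u.1 1 0 * v.1 0 0 + u.1 1 1 * v.1 1 0 := by
    simp [β, Matrix.mul_apply, Fin.sum_univ_two]
  rw [this, (entries u).2, α, α, β, β]

@[simp] theorem α_one : α 1 = 1 := by simp [α]

@[simp] theorem β_one : β 1 = 0 := by simp [β]

@[simp] theorem α_inv (u : Grp) : α u⁻¹ = conj (α u) := rfl

@[simp] theorem β_inv (u : Grp) : β u⁻¹ = -β u := by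
  have : β u⁻¹ = conj (u.1 0 1) := rfl
  rw [this, (entries u).1]; simp

theorem continuous_α : Continuous α := continuous_subtype_val.matrix_elem 0 0

theorem norm_sq_add (u : Grp) : ‖α u‖ ^ 2 + ‖β u‖ ^ 2 = 1 := by
  have h := norm_eq u
  rw [mul_conj, mul_conj, normSq_eq_norm_sq, normSq_eq_norm_sq] at h
  exact_mod_cast h

/-- The diagonal matrix in SU(2) with entries `z` and `conj z`. -/
def diag (z : ℂ) (h : ‖z‖ = 1) : Grp := mk z 0 (by simp [mul_conj, normSq_eq_norm_sq, h])

@[simp] theorem α_diag (z h) : α (diag z h) = z := rfl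

@[simp] theorem β_diag (z h) : β (diag z h) = 0 := rfl

theorem eq_diag {u : Grp} (h : β u = 0) : ∃ hz : ‖α u‖ = 1, u = diag (α u) hz := by
  have h1 := norm_sq_add u
  rw [h] at h1
  simp only [norm_zero] at h1
  have hz : ‖α u‖ = 1 := by nlinarith [norm_nonneg (α u)]
  exact ⟨hz, ext rfl h⟩

/-- The rotation matrix in SU(2) of angle `t`. -/
noncomputable def rot (t : ℝ) : Grp := mk (Real.cos t : ℂ) (Real.sin t : ℂ) (by
  rw [conj_ofReal, conj_ofReal]
  exact_mod_cast (by nlinarith [Real.sin_sq_add_cos_sq t] :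
    Real.cos t * Real.cos t + Real.sin t * Real.sin t = 1))

@[simp] theorem α_rot (t) : α (rot t) = (Real.cos t : ℂ) := rfl

@[simp] theorem β_rot (t) : β (rot t) = (Real.sin t : ℂ) := rfl

theorem continuous_of_entries {X : Type*} [TopologicalSpace X] {f : X → Grp}
    (h1 : Continuous fun x => α (f x)) (h2 : Continuous fun x => β (f x)) : Continuous f := by
  rw [continuous_induced_rng]
  refine continuous_matrix fun i j => ?_
  fin_cases i <;> fin_cases j
  · exact h1
  · exact (continuous_congr fun x => (entries (f x)).1).2 (continuous_conj.comp h2).neg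
  · exact h2
  · exact (continuous_congr fun x => (entries (f x)).2).2 (continuous_conj.comp h1)

theorem continuous_rot : Continuous rot :=
  continuous_of_entries (by simp only [α_rot]; fun_prop) (by simp only [β_rot]; fun_prop)

theorem continuous_diag_exp :
    Continuous fun t : ℝ => diag (exp (t * I)) (norm_exp_ofReal_mul_I t) :=
  continuous_of_entries (by simp only [α_diag]; fun_prop) (by simp only [β_diag]; fun_prop)

theorem eq_or_eq_conj {z w : ℂ} (hz : ‖z‖ = 1) (hw : ‖w‖ = 1) (h : z.re = w.re) :
    z = w ∨ z = conj w := by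
  have h1 : z.re ^ 2 + z.im ^ 2 = 1 := by
    rw [← one_pow 2, ← hz, Complex.sq_norm, normSq_apply]; ring
  have h2 : w.re ^ 2 + w.im ^ 2 = 1 := by
    rw [← one_pow 2, ← hw, Complex.sq_norm, normSq_apply]; ring
  rw [h] at h1
  rcases sq_eq_sq_iff_eq_or_eq_neg.1 (show z.im ^ 2 = w.im ^ 2 by linarith) with h3 | h3
  · exact Or.inl (Complex.ext h h3)
  · exact Or.inr (Complex.ext (by simpa using h) (by simpa using h3))

theorem exists_conj_eq_diag (u : Grp) :
    ∃ (v : Grp) (z : ℂ) (hz : ‖z‖ = 1), z.re = (α u).re ∧ v⁻¹ * u * v = diag z hz := by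
  by_cases hb : β u = 0
  · obtain ⟨hz, hu⟩ := eq_diag hb
    exact ⟨1, α u, hz, rfl, by simpa using hu⟩
  set a := α u with ha
  set b := β u with hb'
  have hn := norm_sq_add u
  rw [Complex.sq_norm, Complex.sq_norm, normSq_apply, normSq_apply, ← ha, ← hb'] at hn
  have hbpos : 0 < b.re * b.re + b.im * b.im := by
    rw [← normSq_apply]; exact normSq_pos.2 hb
  set s := Real.sqrt (1 - a.re ^ 2)
  have hs2 : s ^ 2 = 1 - a.re ^ 2 := Real.sq_sqrt (by nlinarith)
  set d := a.im - s with hd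
  set n := Real.sqrt (b.re * b.re + b.im * b.im + d ^ 2)
  have hn2 : n ^ 2 = b.re * b.re + b.im * b.im + d ^ 2 := Real.sq_sqrt (by positivity)
  have hn0 : n ≠ 0 := by
    intro h; rw [h] at hn2; nlinarith [sq_nonneg d]
  have hz : ‖(⟨a.re, s⟩ : ℂ)‖ = 1 := by
    rw [Complex.norm_def, normSq_apply]
    simp only
    rw [show a.re * a.re + s * s = 1 by nlinarith, Real.sqrt_one]
  have hbb : b * conj b = ((b.re * b.re + b.im * b.im : ℝ) : ℂ) := by
    rw [mul_conj, normSq_apply]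
  have hnC : (n : ℂ) ≠ 0 := by exact_mod_cast hn0
  have hn2C : (n : ℂ) ^ 2 = b * conj b + (d : ℂ) ^ 2 := by
    rw [hbb]; exact_mod_cast hn2
  have hv : conj b / n * conj (conj b / (n : ℂ)) + I * d / n * conj (I * d / (n : ℂ)) = 1 := by
    simp only [map_div₀, map_mul, conj_conj, conj_ofReal, conj_I]
    field_simp
    rw [hn2C, I_sq]; ring
  refine ⟨mk _ _ hv, _, hz, rfl, ?_⟩
  rw [mul_assoc, inv_mul_eq_iff_eq_mul]
  have haz : a = ⟨a.re, s⟩ + I * d := by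
    apply Complex.ext <;> simp [hd]
  have haz' : conj a = ⟨a.re, s⟩ - I * (2 * s + d) := by
    apply Complex.ext <;> simp [hd]; ring
  have key : b * conj b = - d * (2 * s + d) := by
    rw [hbb]; norm_cast; rw [hd]; nlinarith
  apply ext
  · simp only [α_mul, α_mk, β_mk, α_diag, β_diag, ← ha, ← hb']
    field_simp
    linear_combination conj b * haz
  · simp only [β_mul, α_mk, β_mk, α_diag, β_diag, ← ha, ← hb']
    field_simp
    rw [haz', key]
    linear_combination (-(d * (2 * s + d)) : ℂ) * I_sq

theorem eq_one_or_neg_one_of_sq {u : Grp} (h : u * u = 1) :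
    u = 1 ∨ u = diag (-1) (by simp) := by
  have h1 := congrArg α h
  have h2 := congrArg β h
  simp only [α_mul, β_mul, α_one, β_one] at h1 h2
  have hn := norm_eq u
  have hb : β u = 0 := by
    by_contra hb
    have h3 : α u + conj (α u) = 0 := by
      apply mul_left_cancel₀ hb; linear_combination h2
    have h4 : (2 : ℂ) = 0 := by linear_combination α u * h3 - h1 - hn
    norm_num at h4
  rw [hb] at h1
  have h3 : α u = 1 ∨ α u = -1 := by
    apply sq_eq_sq_iff_eq_or_eq_neg.1
    simpa [sq] using h1
  rcases h3 with h3 | h3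
  · exact Or.inl (ext (by simpa using h3) (by simpa using hb))
  · exact Or.inr (ext (by simpa using h3) (by simpa using hb))

theorem eq_top_of_diag_mem {N : Subgroup Grp} [hN : N.Normal]
    (h : ∀ z hz, diag z hz ∈ N) : N = ⊤ := by
  refine (Subgroup.eq_top_iff' N).2 fun u => ?_
  obtain ⟨v, z, hz, -, hv⟩ := exists_conj_eq_diag u
  have := hN.conj_mem _ (h z hz) v
  rwa [← hv, show v * (v⁻¹ * u * v) * v⁻¹ = u by group] at this

theorem diag_mem_of_re_eq {N : Subgroup Grp} [hN : N.Normal] {u : Grp} (hu : u ∈ N)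
    {z : ℂ} (hz : ‖z‖ = 1) (h : z.re = (α u).re) : diag z hz ∈ N := by
  obtain ⟨v, w, hw, hre, hv⟩ := exists_conj_eq_diag u
  have hmem : diag w hw ∈ N := by
    rw [← hv]
    simpa using hN.conj_mem _ hu v⁻¹
  rcases eq_or_eq_conj hz hw (h.trans hre.symm) with h1 | h1
  · subst h1; exact hmem
  · have : diag z hz = (diag w hw)⁻¹ := ext (by simpa using h1) (by simp)
    rw [this]
    exact N.inv_mem hmem

theorem α_diag_pow (z hz) (n : ℕ) : α (diag z hz ^ n) = z ^ n ∧ β (diag z hz ^ n) = 0 := by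
  induction n with
  | zero => simp
  | succ n ih => simp [pow_succ, ih.1, ih.2]

theorem eq_top_of_re_ge {N : Subgroup Grp} [N.Normal] {r : ℝ} (hr : r < 1)
    (h : ∀ z hz, r ≤ z.re → diag z hz ∈ N) : N = ⊤ := by
  refine eq_top_of_diag_mem fun z hz => ?_
  have hlim : Filter.Tendsto (fun n : ℕ => Real.cos (z.arg / n)) Filter.atTop (nhds 1) := by
    have := (Real.continuous_cos.tendsto 0).comp (tendsto_const_div_atTop_nhds_zero_nat z.arg)
    rwa [Real.cos_zero] at this
  obtain ⟨n, hn, hn0⟩ :=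
    ((hlim.eventually (lt_mem_nhds hr)).and (Filter.eventually_ne_atTop 0)).exists
  have hmem := h (exp ((z.arg / n : ℝ) * I)) (norm_exp_ofReal_mul_I _) (by
    rw [exp_ofReal_mul_I_re]; exact hn.le)
  have hpow := N.pow_mem hmem n
  convert hpow using 1
  have hn0' : (n : ℂ) ≠ 0 := by exact_mod_cast hn0
  refine ext ?_ (α_diag_pow _ _ n).2.symm
  rw [(α_diag_pow _ _ n).1, α_diag, ← exp_nat_mul]
  have := norm_mul_exp_arg_mul_I z
  rw [hz] at this
  rw [ofReal_one, one_mul] at this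
  refine this.symm.trans (congrArg exp ?_)
  push_cast
  field_simp

theorem eq_top_of_mem {N : Subgroup Grp} [hN : N.Normal] {u : Grp} (hu : u ∈ N)
    (h1 : u ≠ 1) (h2 : u ≠ diag (-1) (by simp)) : N = ⊤ := by
  obtain ⟨v, z, hz, -, hv⟩ := exists_conj_eq_diag u
  have hmem : diag z hz ∈ N := by
    rw [← hv]
    simpa using hN.conj_mem _ hu v⁻¹
  have hsq : z.re ^ 2 + z.im ^ 2 = 1 := by
    rw [← one_pow 2, ← hz, Complex.sq_norm, normSq_apply]; ring
  have him : z.im ≠ 0 := by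
    intro him
    have hre : z.re = 1 ∨ z.re = -1 := by
      apply sq_eq_sq_iff_eq_or_eq_neg.1
      simpa [him] using hsq
    have hu' : u = v * diag z hz * v⁻¹ := by rw [← hv]; group
    rcases hre with hre | hre
    · have : diag z hz = 1 := ext (Complex.ext hre him) rfl
      exact h1 (by rw [hu', this]; group)
    · have hzz : z = -1 := Complex.ext (by simpa using hre) (by simpa using him)
      have : Commute v (diag z hz) := ext (by simp [hzz]) (by simp [hzz])
      apply h2
      rw [hu', this.eq]
      subst hzz
      group
  have him2 : 0 < z.im ^ 2 := by positivity
  refine eq_top_of_re_ge (r := 1 - 2 * z.im ^ 2) (by linarith) fun w hw hwr => ?_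
  have hw1 : w.re ≤ 1 := hw ▸ re_le_norm w
  set x := (1 - w.re) / (2 * z.im ^ 2)
  have hx0 : 0 ≤ x := div_nonneg (by linarith) (by positivity)
  have hx1 : x ≤ 1 := (div_le_one (by positivity)).2 (by linarith)
  have hs : Real.sqrt x ^ 2 = x := Real.sq_sqrt hx0
  have hle : Real.sqrt x ≤ 1 := Real.sqrt_le_one.2 hx1
  have hsin : Real.sin (Real.arcsin (Real.sqrt x)) = Real.sqrt x :=
    Real.sin_arcsin (by linarith [Real.sqrt_nonneg x]) hle
  have hcos := Real.sin_sq_add_cos_sq (Real.arcsin (Real.sqrt x))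
  set t := Real.arcsin (Real.sqrt x)
  rw [hsin, hs] at hcos
  have hcomm : diag z hz * (rot t * (diag z hz)⁻¹ * (rot t)⁻¹) ∈ N :=
    N.mul_mem hmem (hN.conj_mem _ (N.inv_mem hmem) _)
  refine diag_mem_of_re_eq hcomm hw ?_
  have hre : (α (diag z hz * (rot t * (diag z hz)⁻¹ * (rot t)⁻¹))).re =
      (z.re ^ 2 + z.im ^ 2) * Real.cos t ^ 2 + (z.re ^ 2 - z.im ^ 2) * Real.sin t ^ 2 := by
    simp only [α_mul, β_mul, α_inv, β_inv, α_diag, β_diag, α_rot, β_rot, map_zero, map_mul,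
      conj_ofReal, conj_conj, zero_mul, sub_zero, mul_neg, add_zero, mul_zero, neg_zero]
    simp only [mul_re, sub_re, neg_re, mul_im, sub_im, neg_im, conj_re, conj_im, ofReal_re,
      ofReal_im]
    ring
  have hxe : x * (2 * z.im ^ 2) = 1 - w.re := div_mul_cancel₀ _ (by positivity)
  rw [hre, hsin, hs]
  clear_value x
  linear_combination hxe - (z.re ^ 2 + z.im ^ 2) * hcos - hsq

/-- The diagonal matrix with entries `I` and `-I`. -/
noncomputable def diagI : Grp := diag I norm_I

theorem injective_of_nontrivial (Φ : Grp →* Grp) (h : ¬ ∀ g, Φ g = 1) :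
    Function.Injective Φ := by
  have htop : Φ.ker ≠ ⊤ := fun ht => h fun g => by
    rw [← MonoidHom.mem_ker, ht]; trivial
  have hneg : diag (-1) (by simp) ∉ Φ.ker := by
    intro hmem
    have hsq : diagI * diagI = diag (-1) (by simp) := ext (by simp [diagI]) (by simp [diagI])
    have h1 : Φ diagI * Φ diagI = 1 := by
      rw [← map_mul, hsq]; exact hmem
    have hcomm : Commute (Φ diagI) (Φ (rot (Real.pi / 4))) := by
      rcases eq_one_or_neg_one_of_sq h1 with h2 | h2 <;> rw [h2]
      · exact Commute.one_left _
      · exact ext (by simp) (by simp)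
    have hker : diagI * rot (Real.pi / 4) * diagI⁻¹ * (rot (Real.pi / 4))⁻¹ ∈ Φ.ker := by
      rw [MonoidHom.mem_ker]
      simp only [map_mul, map_inv]
      rw [hcomm.eq]; group
    have hα : α (diagI * rot (Real.pi / 4) * diagI⁻¹ * (rot (Real.pi / 4))⁻¹) = 0 := by
      simp only [diagI, α_mul, β_mul, α_inv, β_inv, α_diag, β_diag, α_rot, β_rot,
        Real.cos_pi_div_four, Real.sin_pi_div_four]
      simp only [map_zero, map_mul, map_add, map_neg, conj_ofReal, conj_I]
      ring
    refine htop (eq_top_of_mem hker (fun h => ?_) (fun h => ?_))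
    · rw [h] at hα; simp at hα
    · rw [h] at hα; simp at hα
  rw [← MonoidHom.ker_eq_bot_iff, Subgroup.eq_bot_iff_forall]
  intro u hu
  by_contra hu1
  exact htop (eq_top_of_mem hu hu1 fun h2 => hneg (h2 ▸ hu))

theorem exists_unit_mul_eq {a b : ℂ} (h : ‖a‖ = ‖b‖) : ∃ p : ℂ, ‖p‖ = 1 ∧ p * a = b := by
  by_cases ha : a = 0
  · refine ⟨1, by simp, ?_⟩
    rw [ha, norm_zero] at h
    rw [ha, norm_eq_zero.1 h.symm, mul_zero]
  · refine ⟨b / a, ?_, div_mul_cancel₀ _ ha⟩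
    rw [norm_div, h, div_self]
    rw [← h]; simpa using ha

theorem exists_diag_mul_mul_diag {u v : Grp} (h : ‖α u‖ = ‖α v‖) :
    ∃ (z w : ℂ) (hz : ‖z‖ = 1) (hw : ‖w‖ = 1), diag z hz * u * diag w hw = v := by
  have hβ : ‖β u‖ = ‖β v‖ := by
    have h1 := norm_sq_add u
    have h2 := norm_sq_add v
    rw [h] at h1
    exact (sq_eq_sq₀ (norm_nonneg _) (norm_nonneg _)).1 (by linarith)
  obtain ⟨p, hp, hpα⟩ := exists_unit_mul_eq h
  obtain ⟨r, hr, hrβ⟩ := exists_unit_mul_eq hβ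
  obtain ⟨w, hw⟩ := IsAlgClosed.exists_pow_nat_eq (p * r) two_pos
  have hw1 : ‖w‖ = 1 := by
    have : ‖w‖ ^ 2 = 1 := by rw [← norm_pow, hw, norm_mul, hp, hr, mul_one]
    nlinarith [norm_nonneg w]
  have hwc : w * conj w = 1 := by simp [mul_conj, normSq_eq_norm_sq, hw1]
  have hpc : p * conj p = 1 := by simp [mul_conj, normSq_eq_norm_sq, hp]
  refine ⟨p * conj w, w, by simp [hp, hw1], hw1, ext ?_ ?_⟩
  · simp
    linear_combination hpα + p * α u * hwc
  · simp
    linear_combination hrβ + r * β u * hpc + conj p * β u * hw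

theorem surjective_of_diagI {Ψ : Grp →* Grp} (hΨ : Continuous Ψ) {l : ℂ} (hl : l ^ 2 = -1)
    (hl1 : ‖l‖ = 1) (hI : Ψ diagI = diag l hl1)
    (hneg : Ψ (diag (-1) (by simp)) = diag (-1) (by simp)) :
    Function.Surjective Ψ := by
  have hl0 : l ≠ 0 := by rintro rfl; simp at hl
  have hlc : conj l = -l := by
    have h1 : l * conj l = 1 := by simp [mul_conj, normSq_eq_norm_sq, hl1]
    apply mul_left_cancel₀ hl0; linear_combination h1 + hl
  have hβ : ∀ z hz, β (Ψ (diag z hz)) = 0 := by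
    intro z hz
    have h1 : diagI * diag z hz = diag z hz * diagI :=
      ext (by simp [diagI, mul_comm]) (by simp [diagI])
    have h2 := congrArg β (congrArg Ψ h1)
    simp only [map_mul, hI, β_mul, α_diag, β_diag, hlc] at h2
    have h3 : l * β (Ψ (diag z hz)) = 0 := by linear_combination (-1 / 2) * h2
    exact (mul_eq_zero.1 h3).resolve_left hl0
  have hdiag : ∀ z hz, diag z hz ∈ Ψ.range := by
    intro z hz
    set f : ℝ → ℝ := fun t => (α (Ψ (diag (exp (t * I)) (norm_exp_ofReal_mul_I t)))).re with hf
    have hfc : Continuous f :=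
      continuous_re.comp (continuous_α.comp (hΨ.comp continuous_diag_exp))
    have h0 : f 0 = 1 := by
      have : diag (exp ((0 : ℝ) * I)) (norm_exp_ofReal_mul_I 0) = 1 := ext (by simp) (by simp)
      simp only [hf, this]; simp
    have hpi : f Real.pi = -1 := by
      have : diag (exp ((Real.pi : ℝ) * I)) (norm_exp_ofReal_mul_I _) = diag (-1) (by simp) :=
        ext (by simp) (by simp)
      simp only [hf, this, hneg]; simp
    have hzre := abs_le.1 ((abs_re_le_norm z).trans hz.le)
    obtain ⟨t, -, ht⟩ := intermediate_value_Icc' Real.pi_pos.le hfc.continuousOn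
      (show z.re ∈ Set.Icc (f Real.pi) (f 0) by rw [h0, hpi]; exact hzre)
    obtain ⟨hn, he⟩ := eq_diag (hβ _ (norm_exp_ofReal_mul_I t))
    rcases eq_or_eq_conj hz hn ht.symm with h1 | h1
    · exact ⟨_, he.trans (ext h1.symm rfl)⟩
    · refine ⟨(diag (exp (t * I)) (norm_exp_ofReal_mul_I t))⁻¹, ?_⟩
      rw [map_inv, he]
      exact ext (by simpa using h1.symm) (by simp)
  have hj : α (Ψ (rot (Real.pi / 2))) = 0 := by
    have h1 : diagI * rot (Real.pi / 2) = diag (-1) (by simp) * rot (Real.pi / 2) * diagI :=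
      ext (by simp [diagI]) (by simp [diagI])
    have h2 := congrArg α (congrArg Ψ h1)
    simp only [map_mul, hI, hneg, α_mul, β_mul, α_diag, β_diag] at h2
    have h3 : l * α (Ψ (rot (Real.pi / 2))) = 0 := by
      simp at h2
      linear_combination (1 / 2) * h2
    exact (mul_eq_zero.1 h3).resolve_left hl0
  intro v
  have hfc : Continuous fun t => ‖α (Ψ (rot t))‖ :=
    (continuous_α.comp (hΨ.comp continuous_rot)).norm
  have h0 : ‖α (Ψ (rot 0))‖ = 1 := by
    have : rot 0 = 1 := ext (by simp) (by simp)
    simp [this]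
  have hv1 : ‖α v‖ ≤ 1 := by
    nlinarith [norm_sq_add v, norm_nonneg (α v), sq_nonneg ‖β v‖]
  obtain ⟨t, -, ht⟩ := intermediate_value_Icc' Real.pi_div_two_pos.le hfc.continuousOn
    (show ‖α v‖ ∈ Set.Icc _ _ by rw [h0, hj, norm_zero]; exact ⟨norm_nonneg _, hv1⟩)
  obtain ⟨z, w, hz, hw, he⟩ := exists_diag_mul_mul_diag ht
  have : v ∈ Ψ.range :=
    he ▸ Ψ.range.mul_mem (Ψ.range.mul_mem (hdiag z hz) ⟨_, rfl⟩) (hdiag w hw)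
  exact this

theorem surjective_of_injective {Φ : Grp →* Grp} (hΦ : Continuous Φ)
    (hinj : Function.Injective Φ) : Function.Surjective Φ := by
  have hneg1 : diag (-1) (by simp) * diag (-1) (by simp) = 1 := ext (by simp) (by simp)
  have hneg : Φ (diag (-1) (by simp)) = diag (-1) (by simp) := by
    refine (eq_one_or_neg_one_of_sq (u := Φ (diag (-1) (by simp))) ?_).resolve_left fun h => ?_
    · rw [← map_mul, hneg1, map_one]
    · have h1 := congrArg α (hinj (h.trans (map_one Φ).symm))
      norm_num at h1
  obtain ⟨v, l, hl1, -, hv⟩ := exists_conj_eq_diag (Φ diagI)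
  obtain ⟨Ψ, hΨ⟩ : ∃ Ψ : Grp →* Grp, ∀ g, Ψ g = v⁻¹ * Φ g * v :=
    ⟨(MulAut.conj v⁻¹).toMonoidHom.comp Φ, fun g => by simp⟩
  have hΨc : Continuous Ψ := by
    rw [funext hΨ]
    exact (continuous_const.mul hΦ).mul continuous_const
  have hΨneg : Ψ (diag (-1) (by simp)) = diag (-1) (by simp) := by
    have h3 := norm_eq v
    rw [hΨ, hneg]
    refine ext ?_ ?_
    · simp only [α_mul, β_mul, α_inv, β_inv, α_diag, β_diag, map_neg, map_add, map_mul, map_one,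
        map_zero, conj_conj]
      linear_combination -h3
    · simp only [α_mul, β_mul, α_inv, β_inv, α_diag, β_diag, map_neg, map_sub, map_mul,
        map_one, map_zero, conj_conj]
      ring
  have hl : l ^ 2 = -1 := by
    have hsq : diagI * diagI = diag (-1) (by simp) := ext (by simp [diagI]) (by simp [diagI])
    have h1 := congrArg α (congrArg Ψ hsq)
    rw [hΨneg, map_mul, hΨ, hv] at h1
    simpa [sq] using h1
  intro g
  obtain ⟨x, hx⟩ := surjective_of_diagI hΨc hl hl1 ((hΨ _).trans hv) hΨneg (v⁻¹ * g * v)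
  refine ⟨x, ?_⟩
  rw [hΨ] at hx
  exact mul_left_cancel (mul_right_cancel hx)

end SU2

/-- Every continuous group homomorphism `Φ : SU(2) → SU(2)` is either trivial
or bijective. -/
theorem continuous_hom_SU2_to_SU2_trivial_or_bijective
    (Φ : ↥(Matrix.specialUnitaryGroup (Fin 2) ℂ) →* ↥(Matrix.specialUnitaryGroup (Fin 2) ℂ))
    (hΦ : Continuous Φ) :
    (∀ g, Φ g = 1) ∨ Function.Bijective Φ := by
  by_cases h : ∀ g, Φ g = 1
  · exact Or.inl h
  · have hinj := SU2.injective_of_nontrivial Φ h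
    exact Or.inr ⟨hinj, SU2.surjective_of_injective hΦ hinj⟩
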